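/- For n ≥ 3 the specialized partition function f(1ₙ) = αₙ · F_id(x₁,…,xₙ, qx₁,…,qxₙ) satisfies the wheel conditions: substituting (x₁,x₂,x₃) = (x, t·x, q·x) gives f(1ₙ)(x, tx, qx, x₄,…,xₙ) = 0, and substituting (x₁,x₂,x₃) = (tq·x, t·x, q·x) gives f(1ₙ)(tqx, tx, qx, x₄,…,xₙ) = 0, where x is a new indeterminate. -/

import Mathlib

open Finset

noncomputable section

/-- The ambient field: fraction field of polynomials over `ℚ` in countably many
indeterminates; `qq`, `tt` and the `xx i`, `yy i` below are algebraically independent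
indeterminates, so identities among them are identities of rational functions
in `q`, `t` and the `x i` (and `y i`) over `ℚ`. -/
abbrev F : Type := FractionRing (MvPolynomial ℕ ℚ)

def gen (i : ℕ) : F := algebraMap (MvPolynomial ℕ ℚ) F (MvPolynomial.X i)

/-- the indeterminate `q` -/
def qq : F := gen 0
/-- the indeterminate `t` -/
def tt : F := gen 1
/-- the indeterminate `x_{i+1}` (0-based) -/
def xx (i : ℕ) : F := gen (2 + 2 * i)
/-- the indeterminate `y_{i+1}` (0-based) -/
def yy (i : ℕ) : F := gen (3 + 2 * i)

/-- labelings of the `2n` edge positions by values in `{1,…,n+1}` (0-based). -/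
abbrev Lab (n : ℕ) := Fin (2 * n) → Fin (n + 1)

abbrev Mat (n : ℕ) := Matrix (Lab n) (Lab n) F

/-- the structure constant `c((a,b),(a',b'))` of the generator `T`. -/
def Tcoeff (n : ℕ) (a b a' b' : Fin (n + 1)) : F :=
  if a' = a ∧ b' = b ∧ b < a then tt - 1
  else if a' = b ∧ b' = a ∧ a < b then 1
  else if a' = b ∧ b' = a ∧ b ≤ a then tt
  else 0

/-- the (standard, column-convention) matrix of `T_i` acting at 0-based positions `p, p+1`:
the `(κ, κ')` entry is the coefficient of `e_κ` in `T e_{κ'}`. -/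
def Tmat (n : ℕ) (p : ℕ) : Mat n :=
  Matrix.of fun κ κ' =>
    if h : p + 1 < 2 * n then
      if ∀ j : Fin (2 * n), (j : ℕ) ≠ p → (j : ℕ) ≠ p + 1 → κ j = κ' j then
        Tcoeff n (κ' ⟨p, by omega⟩) (κ' ⟨p + 1, h⟩) (κ ⟨p, by omega⟩) (κ ⟨p + 1, h⟩)
      else 0
    else 0

/-- `Ř_i(u) = (1−t)·Id + (1−u)·T_i` at 0-based position `p`. -/
def Rmat (n : ℕ) (p : ℕ) (u : F) : Mat n := (1 - tt) • (1 : Mat n) + (1 - u) • Tmat n p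

/-- the ordered product `Z = ∏_{j=1}^{n} (Ř_{n+j−1}(xₙ/y_j)·Ř_{n+j−2}(x_{n−1}/y_j)⋯Ř_j(x₁/y_j))`,
columns `j = 1,…,n` multiplied left to right (matrices in the standard convention, so that
an operator product written left to right is the corresponding matrix product). -/
def Zmat (n : ℕ) (x y : ℕ → F) : Mat n :=
  ((List.range n).map fun j =>
    ((List.range n).map fun r => Rmat n (j + (n - 1 - r)) (x (n - 1 - r) / y j)).prod).prod

/-- the labeling `(ω̄(v(1)),…,ω̄(v(2n)))` of `|v⟩` for `v ∈ Sₙ ⊂ S_{2n}`. -/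
def labP (n : ℕ) (v : Equiv.Perm (Fin n)) : Lab n := fun p =>
  if h : (p : ℕ) < n then Fin.castSucc (v ⟨p, h⟩) else Fin.last n

/-- the number of inversions (Coxeter length) of a permutation. -/
def ell {n : ℕ} (v : Equiv.Perm (Fin n)) : ℕ :=
  ((Finset.univ : Finset (Fin n × Fin n)).filter fun p => p.1 < p.2 ∧ v p.2 < v p.1).card

/-- `αₙ = (q/t)^{n(n−1)/2} (1−t)^{−n}`. -/
def alpha (n : ℕ) : F := (qq / tt) ^ (n * (n - 1) / 2) * (1 - tt)⁻¹ ^ n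

/-- the matrix element `F_v = ⟨1| Z |v⟩`. -/
def Fv (n : ℕ) (x y : ℕ → F) (v : Equiv.Perm (Fin n)) : F :=
  Zmat n x y (labP n 1) (labP n v)

/-- `f(1ₙ) = αₙ · F_id(x₁,…,xₙ, qx₁,…,qxₙ)` as a function of the values `x`. -/
def pf1 (n : ℕ) (x : ℕ → F) : F :=
  alpha n * Zmat n x (fun i => qq * x i) (labP n 1) (labP n 1)

/-- The coefficient of `A κ` in row `κ` of `T A`, for labels `(a, b)` at the two positions. -/
def diagCoeff {n : ℕ} (a b : Fin (n + 1)) : F := if b < a then tt - 1 else 0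

/-- The coefficient of the swapped row in row `κ` of `T A`. -/
def swapCoeff {n : ℕ} (a b : Fin (n + 1)) : F := if b < a then 1 else tt

/-- The labeling with the labels at positions `i` and `j` exchanged. -/
def swapLab {n : ℕ} (i j : Fin (2 * n)) (κ : Lab n) : Lab n :=
  Function.update (Function.update κ i (κ j)) j (κ i)

theorem swapLab_eq_self {n : ℕ} {i j : Fin (2 * n)} {κ : Lab n} (h : κ i = κ j) :
    swapLab i j κ = κ := by
  unfold swapLab
  rw [← h, Function.update_eq_self, h, Function.update_eq_self]

theorem eq_swapLab_iff {n p : ℕ} (h : p + 1 < 2 * n) (κ μ : Lab n) :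
    μ = swapLab ⟨p, by omega⟩ ⟨p + 1, h⟩ κ ↔
      (∀ j : Fin (2 * n), (j : ℕ) ≠ p → (j : ℕ) ≠ p + 1 → κ j = μ j) ∧
        μ ⟨p, by omega⟩ = κ ⟨p + 1, h⟩ ∧ μ ⟨p + 1, h⟩ = κ ⟨p, by omega⟩ := by
  constructor
  · rintro rfl
    refine ⟨fun j h1 h2 => ?_, ?_, ?_⟩ <;> simp_all [swapLab, Fin.ext_iff]
  · rintro ⟨h1, h2, h3⟩
    ext1 j
    simp only [swapLab, Function.update_apply]
    split_ifs with h4 h5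
    · rw [← h3, h4]
    · rw [← h2, h5]
    · exact (h1 j (fun h => h5 (Fin.ext h)) fun h => h4 (Fin.ext h)).symm

theorem eq_iff_forall_ne {n p : ℕ} (h : p + 1 < 2 * n) (κ μ : Lab n) :
    μ = κ ↔
      (∀ j : Fin (2 * n), (j : ℕ) ≠ p → (j : ℕ) ≠ p + 1 → κ j = μ j) ∧
        μ ⟨p, by omega⟩ = κ ⟨p, by omega⟩ ∧ μ ⟨p + 1, h⟩ = κ ⟨p + 1, h⟩ := by
  constructor
  · rintro rfl
    simp
  · rintro ⟨h1, h2, h3⟩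
    ext1 j
    by_cases h4 : (j : ℕ) = p
    · rwa [show j = ⟨p, by omega⟩ from Fin.ext h4]
    by_cases h5 : (j : ℕ) = p + 1
    · rwa [show j = ⟨p + 1, h⟩ from Fin.ext h5]
    · exact (h1 j h4 h5).symm

theorem Tmat_apply {n p : ℕ} (h : p + 1 < 2 * n) (κ μ : Lab n) :
    Tmat n p κ μ =
      (if μ = κ then diagCoeff (κ ⟨p, by omega⟩) (κ ⟨p + 1, h⟩) else 0) +
        (if μ = swapLab ⟨p, by omega⟩ ⟨p + 1, h⟩ κ then
          swapCoeff (κ ⟨p, by omega⟩) (κ ⟨p + 1, h⟩) else 0) := by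
  simp only [eq_swapLab_iff h, eq_iff_forall_ne h κ μ, Tmat, Matrix.of_apply, dif_pos h]
  by_cases hj : ∀ j : Fin (2 * n), (j : ℕ) ≠ p → (j : ℕ) ≠ p + 1 → κ j = μ j
  · simp only [if_pos hj, Tcoeff, diagCoeff, swapCoeff]
    generalize κ ⟨p, _⟩ = a
    generalize κ ⟨p + 1, _⟩ = b
    generalize μ ⟨p, _⟩ = c
    generalize μ ⟨p + 1, _⟩ = d
    grind
  · simp [hj]

theorem Tmat_mul_apply {n p : ℕ} (h : p + 1 < 2 * n) (A : Mat n) (κ lam : Lab n) :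
    (Tmat n p * A) κ lam =
      diagCoeff (κ ⟨p, by omega⟩) (κ ⟨p + 1, h⟩) * A κ lam +
        swapCoeff (κ ⟨p, by omega⟩) (κ ⟨p + 1, h⟩) *
          A (swapLab ⟨p, by omega⟩ ⟨p + 1, h⟩ κ) lam := by
  simp [Matrix.mul_apply, Tmat_apply h, add_mul, Finset.sum_add_distrib]

theorem Tmat_sq {n p : ℕ} (h : p + 1 < 2 * n) :
    Tmat n p * Tmat n p = (tt - 1) • Tmat n p + tt • (1 : Mat n) := by
  suffices H : ∀ A : Mat n, Tmat n p * (Tmat n p * A) = (tt - 1) • (Tmat n p * A) + tt • A by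
    simpa using H 1
  intro A
  ext κ lam
  have hne : (⟨p, by omega⟩ : Fin (2 * n)) ≠ ⟨p + 1, h⟩ := by simp
  simp only [Tmat_mul_apply h, Matrix.add_apply, Matrix.smul_apply, smul_eq_mul]
  generalize (⟨p, _⟩ : Fin (2 * n)) = i at *
  generalize (⟨p + 1, _⟩ : Fin (2 * n)) = j at *
  have h1 : swapLab i j κ i = κ j := by simp [swapLab, hne]
  have h2 : swapLab i j κ j = κ i := by simp [swapLab]
  have h3 : swapLab i j (swapLab i j κ) = κ := by
    ext1 k
    simp only [swapLab, Function.update_apply]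
    grind
  rw [h1, h2, h3]
  rcases lt_trichotomy (κ i) (κ j) with hlt | heq | hlt
  · simp [diagCoeff, swapCoeff, hlt, hlt.not_gt]
    ring
  · rw [swapLab_eq_self heq]
    simp [diagCoeff, swapCoeff, heq]
    ring
  · simp [diagCoeff, swapCoeff, hlt, hlt.not_gt]

theorem Tmat_braid {n p : ℕ} (h : p + 2 < 2 * n) :
    Tmat n p * Tmat n (p + 1) * Tmat n p = Tmat n (p + 1) * Tmat n p * Tmat n (p + 1) := by
  suffices H : ∀ A : Mat n, Tmat n p * (Tmat n (p + 1) * (Tmat n p * A)) =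
      Tmat n (p + 1) * (Tmat n p * (Tmat n (p + 1) * A)) by
    simpa [mul_assoc] using H 1
  intro A
  ext κ lam
  have hp : p + 1 < 2 * n := by omega
  simp only [Tmat_mul_apply hp, Tmat_mul_apply h]
  have hij : (⟨p, by omega⟩ : Fin (2 * n)) ≠ ⟨p + 1, hp⟩ := by simp
  have hjk : (⟨p + 1, hp⟩ : Fin (2 * n)) ≠ ⟨p + 1 + 1, h⟩ := by simp
  have hik : (⟨p, by omega⟩ : Fin (2 * n)) ≠ ⟨p + 1 + 1, h⟩ := by simp; omega
  generalize (⟨p, _⟩ : Fin (2 * n)) = i at *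
  generalize (⟨p + 1, _⟩ : Fin (2 * n)) = j at *
  generalize (⟨p + 1 + 1, _⟩ : Fin (2 * n)) = k at *
  obtain ⟨u, hu⟩ : ∃ u : Fin (n + 1) → Fin (n + 1) → Fin (n + 1) → Lab n,
      ∀ a b c, u a b c = Function.update (Function.update (Function.update κ i a) j b) k c :=
    ⟨_, fun _ _ _ => rfl⟩
  have ui : ∀ a b c, u a b c i = a := by intro a b c; simp [hu, hij, hik]
  have uj : ∀ a b c, u a b c j = b := by intro a b c; simp [hu, hjk]
  have uk : ∀ a b c, u a b c k = c := by intro a b c; simp [hu]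
  have us : ∀ a b c, swapLab i j (u a b c) = u b a c := by
    intro a b c
    ext1 l
    simp only [swapLab, ui, uj, hu, Function.update_apply]
    grind
  have ut : ∀ a b c, swapLab j k (u a b c) = u a c b := by
    intro a b c
    ext1 l
    simp only [swapLab, uk, uj, hu, Function.update_apply]
    grind
  have hκ : κ = u (κ i) (κ j) (κ k) := by
    ext1 l
    simp only [hu, Function.update_apply]
    grind
  obtain ⟨a, b, c, hκ⟩ : ∃ a b c, κ = u a b c := ⟨_, _, _, hκ⟩
  rw [hκ]
  simp only [us, ut, ui, uj, uk]
  clear hκ us ut ui uj uk hu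
  unfold diagCoeff swapCoeff
  rcases lt_trichotomy a b with h1 | h1 | h1 <;> rcases lt_trichotomy b c with h2 | h2 | h2 <;>
    rcases lt_trichotomy a c with h3 | h3 | h3 <;> subst_vars <;>
    first
    | (exfalso; order)
    | (simp [*, lt_asymm]; done)
    | (simp [*, lt_asymm]; ring)

theorem Tmat_commute {n p r : ℕ} (hpr : p + 2 ≤ r) : Commute (Tmat n p) (Tmat n r) := by
  by_cases h : r + 1 < 2 * n
  swap
  · have : Tmat n r = 0 := by
      ext κ μ
      simp [Tmat, h]
    rw [this]
    exact Commute.zero_right _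
  have hp : p + 1 < 2 * n := by omega
  suffices H : ∀ A : Mat n, Tmat n p * (Tmat n r * A) = Tmat n r * (Tmat n p * A) by
    simpa [Commute, SemiconjBy] using H 1
  intro A
  ext κ lam
  simp only [Tmat_mul_apply hp, Tmat_mul_apply h]
  have h1 : (⟨p, by omega⟩ : Fin (2 * n)) ≠ ⟨p + 1, hp⟩ := by simp
  have h2 : (⟨r, by omega⟩ : Fin (2 * n)) ≠ ⟨r + 1, h⟩ := by simp
  have h3 : (⟨p, by omega⟩ : Fin (2 * n)) ≠ ⟨r, by omega⟩ := by simp; omega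
  have h4 : (⟨p, by omega⟩ : Fin (2 * n)) ≠ ⟨r + 1, h⟩ := by simp; omega
  have h5 : (⟨p + 1, hp⟩ : Fin (2 * n)) ≠ ⟨r, by omega⟩ := by simp; omega
  have h6 : (⟨p + 1, hp⟩ : Fin (2 * n)) ≠ ⟨r + 1, h⟩ := by simp; omega
  generalize (⟨p, _⟩ : Fin (2 * n)) = i at *
  generalize (⟨p + 1, _⟩ : Fin (2 * n)) = j at *
  generalize (⟨r, _⟩ : Fin (2 * n)) = k at *
  generalize (⟨r + 1, _⟩ : Fin (2 * n)) = l at *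
  have e1 : swapLab i j κ k = κ k := by simp [swapLab, h3.symm, h5.symm]
  have e2 : swapLab i j κ l = κ l := by simp [swapLab, h4.symm, h6.symm]
  have e3 : swapLab k l κ i = κ i := by simp [swapLab, h3, h4]
  have e4 : swapLab k l κ j = κ j := by simp [swapLab, h5, h6]
  have e5 : swapLab k l (swapLab i j κ) = swapLab i j (swapLab k l κ) := by
    ext1 m
    simp only [swapLab, Function.update_apply]
    grind
  rw [e1, e2, e3, e4, e5]
  ring

theorem Rmat_commute {n p r : ℕ} (hpr : p + 2 ≤ r) (u v : F) :
    Commute (Rmat n p u) (Rmat n r v) := by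
  exact (((Commute.one_left _).smul_left _).add_left
    ((((Commute.one_right _).smul_right _).add_right ((Tmat_commute hpr).smul_right _)).smul_left _))

theorem Rmat_one (n p : ℕ) : Rmat n p 1 = (1 - tt) • (1 : Mat n) := by
  simp [Rmat]

theorem yang_baxter_of_hecke {R M : Type*} [CommRing R] [Ring M] [Algebra R M] {t : R} {A B : M}
    (hA : A * A = (t - 1) • A + t • 1) (hB : B * B = (t - 1) • B + t • 1)
    (hAB : A * B * A = B * A * B) (u v : R) :
    ((1 - t) • 1 + (1 - u) • A) * ((1 - t) • 1 + (1 - u * v) • B) * ((1 - t) • 1 + (1 - v) • A) =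
      ((1 - t) • 1 + (1 - v) • B) * ((1 - t) • 1 + (1 - u * v) • A) *
        ((1 - t) • 1 + (1 - u) • B) := by
  simp only [mul_add, add_mul, smul_mul_assoc, mul_smul_comm, smul_smul, mul_one, one_mul, smul_add,
    hA, hB, hAB]
  module

/-- The Yang–Baxter equation for the `R`-matrix. -/
theorem Rmat_yang_baxter {n p : ℕ} (h : p + 2 < 2 * n) (u v : F) :
    Rmat n p u * Rmat n (p + 1) (u * v) * Rmat n p v =
      Rmat n (p + 1) v * Rmat n p (u * v) * Rmat n (p + 1) u :=
  yang_baxter_of_hecke (Tmat_sq (by omega)) (Tmat_sq h) (Tmat_braid h) u v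

theorem Rmat_mul_apply_of_eq {n p : ℕ} (h : p + 1 < 2 * n) {κ : Lab n}
    (hκ : κ ⟨p, by omega⟩ = κ ⟨p + 1, h⟩) (u : F) (A : Mat n) (lam : Lab n) :
    (Rmat n p u * A) κ lam = (1 - u * tt) * A κ lam := by
  simp only [Rmat, add_mul, smul_mul_assoc, one_mul, Matrix.add_apply, Matrix.smul_apply,
    smul_eq_mul, Tmat_mul_apply h, swapLab_eq_self hκ, hκ, diagCoeff, swapCoeff, lt_irrefl,
    if_false]
  ring

theorem mul_Rmat_apply_of_eq {n p : ℕ} (h : p + 1 < 2 * n) {κ : Lab n}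
    (hκ : κ ⟨p, by omega⟩ = κ ⟨p + 1, h⟩) (u : F) (A : Mat n) (lam : Lab n) :
    (A * Rmat n p u) lam κ = A lam κ * (1 - u * tt) := by
  have key : ∀ μ : Lab n, Tmat n p μ κ = if μ = κ then tt else 0 := by
    intro μ
    by_cases hμ : μ = κ
    · subst hμ
      simp [Tmat_apply h, swapLab_eq_self hκ, hκ, diagCoeff, swapCoeff]
    · have h1 : κ ≠ swapLab ⟨p, by omega⟩ ⟨p + 1, h⟩ μ := by
        intro h2
        have h3 := (eq_swapLab_iff h μ κ).1 h2
        exact hμ ((eq_iff_forall_ne h κ μ).2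
          ⟨fun j h4 h5 => (h3.1 j h4 h5).symm, by rw [hκ, h3.2.2], by rw [← hκ, h3.2.1]⟩)
      simp [Tmat_apply h, hμ, Ne.symm hμ, h1]
  have hT : (A * Tmat n p) lam κ = A lam κ * tt := by
    simp [Matrix.mul_apply, key]
  simp only [Rmat, mul_add, mul_smul_comm, mul_one, Matrix.add_apply, Matrix.smul_apply,
    smul_eq_mul, hT]
  ring

/-- The descending product `g (m - 1) * ⋯ * g 1 * g 0`. -/
def descProd {M : Type*} [Monoid M] (g : ℕ → M) : ℕ → M
  | 0 => 1
  | m + 1 => g m * descProd g m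

theorem prod_map_range_eq_descProd {M : Type*} [Monoid M] (g : ℕ → M) (n : ℕ) :
    ((List.range n).map fun r => g (n - 1 - r)).prod = descProd g n := by
  induction n with
  | zero => rfl
  | succ n ih =>
    rw [List.range_succ_eq_map, List.map_cons, List.map_map, List.prod_cons, descProd, ← ih]
    congr 3
    ext r
    simp only [Function.comp]
    congr 1
    omega

theorem descProd_add {M : Type*} [Monoid M] (g : ℕ → M) (m k : ℕ) :
    descProd g (m + k) = descProd (fun i => g (i + k)) m * descProd g k := by
  induction m with
  | zero => simp [descProd]
  | succ m ih => rw [Nat.succ_add, descProd, descProd, ih, mul_assoc]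

theorem descProd_add_three {M : Type*} [Monoid M] (g : ℕ → M) (m : ℕ) :
    descProd g (m + 3) = descProd (fun i => g (i + 3)) m * (g 2 * g 1 * g 0) := by
  rw [descProd_add]
  simp [descProd, mul_assoc]

theorem commute_descProd {M : Type*} [Monoid M] {a : M} {g : ℕ → M} {m : ℕ}
    (h : ∀ i < m, Commute a (g i)) : Commute a (descProd g m) := by
  induction m with
  | zero => exact Commute.one_right a
  | succ m ih =>
    exact (h m (by omega)).mul_right (ih fun i hi => h i (by omega))

/-- The `j`-th column (0-based) of the lattice operator. -/
def colMat (n : ℕ) (x : ℕ → F) (y : F) (j : ℕ) : Mat n :=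
  descProd (fun i => Rmat n (j + i) (x i / y)) n

theorem Zmat_add_two (m : ℕ) (x y : ℕ → F) :
    Zmat (m + 2) x y = colMat (m + 2) x (y 0) 0 * colMat (m + 2) x (y 1) 1 *
      ((List.range m).map fun j => colMat (m + 2) x (y (j + 2)) (j + 2)).prod := by
  have h : ∀ j, ((List.range (m + 2)).map fun r => Rmat (m + 2) (j + (m + 2 - 1 - r))
      (x (m + 2 - 1 - r) / y j)).prod = colMat (m + 2) x (y j) j := fun j =>
    prod_map_range_eq_descProd (fun i => Rmat (m + 2) (j + i) (x i / y j)) (m + 2)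
  simp only [Zmat, h]
  rw [List.range_succ_eq_map, List.map_cons, List.map_map, List.range_succ_eq_map]
  simp [mul_assoc, Function.comp_def]

/-- A crossing of two vertical lines slides through the horizontal lines crossing both. -/
theorem descProd_Rmat_mul_Rmat {n p : ℕ} (x : ℕ → F) {y y' : F} (hy : y ≠ 0) (m : ℕ)
    (hm : p + m + 1 < 2 * n) :
    descProd (fun i => Rmat n (p + i) (x i / y)) m *
        descProd (fun i => Rmat n (p + 1 + i) (x i / y')) m * Rmat n p (y / y') =
      Rmat n (p + m) (y / y') * (descProd (fun i => Rmat n (p + i) (x i / y')) m *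
        descProd (fun i => Rmat n (p + 1 + i) (x i / y)) m) := by
  induction m with
  | zero => simp [descProd]
  | succ m ih =>
    have ih := ih (by omega)
    have hyb := Rmat_yang_baxter (n := n) (p := p + m) (by omega) (x m / y) (y / y')
    rw [div_mul_div_cancel₀ hy] at hyb
    have hc : ∀ u z, Commute (Rmat n (p + m + 1) u)
        (descProd (fun i => Rmat n (p + i) (x i / z)) m) := fun u z =>
      commute_descProd fun i hi => (Rmat_commute (by omega) _ _).symm
    simp only [descProd]
    have h1 := (hc (x m / y') y).eq
    have h2 := (hc (x m / y) y').eq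
    rw [add_right_comm p 1 m, ← add_assoc]
    generalize descProd (fun i => Rmat n (p + i) (x i / y)) m = L₁ at *
    generalize descProd (fun i => Rmat n (p + 1 + i) (x i / y')) m = L₂ at *
    generalize descProd (fun i => Rmat n (p + i) (x i / y')) m = L₃ at *
    generalize descProd (fun i => Rmat n (p + 1 + i) (x i / y)) m = L₄ at *
    calc _ = Rmat n (p + m) (x m / y) * (L₁ * Rmat n (p + m + 1) (x m / y')) *
          (L₂ * Rmat n p (y / y')) := by simp only [mul_assoc]
      _ = Rmat n (p + m) (x m / y) * Rmat n (p + m + 1) (x m / y') *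
          (L₁ * L₂ * Rmat n p (y / y')) := by rw [← h1]; simp only [mul_assoc]
      _ = Rmat n (p + m) (x m / y) * Rmat n (p + m + 1) (x m / y') * Rmat n (p + m) (y / y') *
          (L₃ * L₄) := by rw [ih]; simp only [mul_assoc]
      _ = Rmat n (p + m + 1) (y / y') * Rmat n (p + m) (x m / y') *
          (Rmat n (p + m + 1) (x m / y) * L₃) * L₄ := by rw [hyb]; simp only [mul_assoc]
      _ = _ := by rw [h2]; simp only [mul_assoc]

theorem labP_of_le {n : ℕ} (v : Equiv.Perm (Fin n)) {p : Fin (2 * n)} (h : n ≤ p) :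
    labP n v p = Fin.last n := by
  simp [labP, h.not_gt]

theorem tt_ne_zero : tt ≠ 0 := by
  simp [tt, gen]

theorem qq_ne_zero : qq ≠ 0 := by
  simp [qq, gen]

theorem yy_ne_zero (i : ℕ) : yy i ≠ 0 := by
  simp [yy, gen]

theorem Zmat_labP_left_eq_zero {n : ℕ} (hn : 3 ≤ n) {x y : ℕ → F} (hy : y 0 ≠ 0)
    (hx : x 2 = y 0) (hyt : y 1 = tt * y 0) (v : Equiv.Perm (Fin n)) (κ : Lab n) :
    Zmat n x y (labP n v) κ = 0 := by
  obtain ⟨m, rfl⟩ := Nat.exists_eq_add_of_le' hn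
  set N := m + 3 with hN
  have hZ := Zmat_add_two (m + 1) x y
  rw [show m + 1 + 2 = N from rfl] at hZ
  rw [hZ]
  generalize (List.map (fun j => colMat N x (y (j + 2)) (j + 2)) (List.range (m + 1))).prod = W
  have hslide := descProd_Rmat_mul_Rmat (n := N) (p := 3) (fun i => x (i + 3)) (y' := y 1) hy m
    (by omega)
  have hcol0 : colMat N x (y 0) 0 = (1 - tt) • (descProd (fun i => Rmat N (3 + i)
      (x (i + 3) / y 0)) m * (Rmat N 1 (x 1 / y 0) * Rmat N 0 (x 0 / y 0))) := by
    rw [colMat, descProd_add_three, hx, div_self hy]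
    simp [Rmat_one, add_comm]
  have hcol1 : colMat N x (y 1) 1 = descProd (fun i => Rmat N (3 + 1 + i)
      (x (i + 3) / y 1)) m * Rmat N 3 (y 0 / y 1) *
        (Rmat N 2 (x 1 / y 1) * Rmat N 1 (x 0 / y 1)) := by
    rw [colMat, descProd_add_three, hx]
    simp only [mul_assoc]
    congr 3
    ext1 i
    congr 1
    omega
  rw [hcol0, hcol1]
  have hc : Commute (Rmat N 1 (x 1 / y 0) * Rmat N 0 (x 0 / y 0))
      (descProd (fun i => Rmat N (3 + 1 + i) (x (i + 3) / y 1)) m * Rmat N 3 (y 0 / y 1)) := by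
    refine Commute.mul_right ?_ ?_
    · refine commute_descProd fun i hi => ?_
      exact (Rmat_commute (by omega) _ _).mul_left (Rmat_commute (by omega) _ _)
    · exact (Rmat_commute (by omega) _ _).mul_left (Rmat_commute (by omega) _ _)
  generalize Rmat N 1 (x 1 / y 0) * Rmat N 0 (x 0 / y 0) = P at *
  generalize Rmat N 2 (x 1 / y 1) * Rmat N 1 (x 0 / y 1) = Q at *
  generalize descProd (fun i => Rmat N (3 + i) (x (i + 3) / y 0)) m = L₁ at *
  generalize descProd (fun i => Rmat N (3 + 1 + i) (x (i + 3) / y 1)) m = L₂ at *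
  obtain ⟨B, hB⟩ : ∃ B, L₁ * L₂ * Rmat N 3 (y 0 / y 1) = Rmat N (3 + m) (y 0 / y 1) * B :=
    ⟨_, hslide⟩
  have hprod : (1 - tt) • (L₁ * P) * (L₂ * Rmat N 3 (y 0 / y 1) * Q) * W =
      Rmat N (3 + m) (y 0 / y 1) * ((1 - tt) • (B * (P * Q * W))) := by
    calc _ = (1 - tt) • (L₁ * (P * (L₂ * Rmat N 3 (y 0 / y 1))) * (Q * W)) := by
          simp only [smul_mul_assoc, mul_assoc]
      _ = (1 - tt) • ((L₁ * L₂ * Rmat N 3 (y 0 / y 1)) * (P * Q * W)) := by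
          rw [hc.eq]; simp only [mul_assoc]
      _ = _ := by rw [hB]; simp only [mul_smul_comm, mul_assoc]
  rw [hprod, Rmat_mul_apply_of_eq (by omega), hyt, div_mul_eq_mul_div, mul_comm (y 0) tt, div_self,
    sub_self, zero_mul]
  · exact mul_ne_zero tt_ne_zero hy
  · rw [labP_of_le, labP_of_le] <;> simp <;> omega

theorem mul_eq_mul_of_braid {M : Type*} [Monoid M] {a₁ a₂ b₀ b₁ h r₂ r₁ r₁' r₀ s₂ s₁ s₀ : M}
    (h₁ : b₀ * r₁ * r₀ = s₁ * s₀ * b₁) (h₂ : a₁ * r₂ * s₁ = s₂ * r₁' * a₂)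
    (hb : Commute b₀ r₂) (ha : Commute s₀ a₂) (hh : Commute (a₁ * b₀) h) :
    a₁ * b₀ * (h * (r₂ * r₁ * r₀)) = h * (s₂ * r₁' * s₀) * (a₂ * b₁) := by
  calc _ = h * (a₁ * (b₀ * r₂) * (r₁ * r₀)) := by rw [← mul_assoc, hh.eq]; simp only [mul_assoc]
    _ = h * (a₁ * r₂ * (b₀ * r₁ * r₀)) := by rw [hb.eq]; simp only [mul_assoc]
    _ = h * ((a₁ * r₂ * s₁) * s₀ * b₁) := by rw [h₁]; simp only [mul_assoc]
    _ = h * (s₂ * r₁' * (s₀ * a₂) * b₁) := by rw [h₂, ha.eq]; simp only [mul_assoc]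
    _ = _ := by simp only [mul_assoc]

theorem Rmat_pair_mul_colMat {n j : ℕ} (hn : 3 ≤ n) (hj : j < n) (x : ℕ → F) (y : F)
    (hx : x 0 ≠ 0) :
    ∃ C, Rmat n (j + 1) (x 2 / x 0) * Rmat n j (x 1 / x 0) * colMat n x y j =
      C * (Rmat n (j + 2) (x 2 / x 0) * Rmat n (j + 1) (x 1 / x 0)) := by
  obtain ⟨m, rfl⟩ := Nat.exists_eq_add_of_le' hn
  have y1 := Rmat_yang_baxter (n := m + 3) (p := j) (by omega) (x 1 / x 0) (x 0 / y)
  have y2 := Rmat_yang_baxter (n := m + 3) (p := j + 1) (by omega) (x 2 / x 0) (x 0 / y)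
  rw [div_mul_div_cancel₀ hx] at y1 y2
  rw [colMat, descProd_add_three]
  have hH : Commute (Rmat (m + 3) (j + 1) (x 2 / x 0) * Rmat (m + 3) j (x 1 / x 0))
      (descProd (fun i => Rmat (m + 3) (j + (i + 3)) (x (i + 3) / y)) m) :=
    commute_descProd fun i hi =>
      (Rmat_commute (by omega) _ _).mul_left (Rmat_commute (by omega) _ _)
  exact ⟨_, mul_eq_mul_of_braid y1 y2 (Rmat_commute le_rfl _ _) (Rmat_commute le_rfl _ _) hH⟩

theorem Rmat_pair_mul_prod_colMat {n j : ℕ} (hn : 3 ≤ n) (x y : ℕ → F) (hx : x 0 ≠ 0) (k : ℕ)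
    (hk : j + k ≤ n) :
    ∃ C, Rmat n (j + 1) (x 2 / x 0) * Rmat n j (x 1 / x 0) *
        ((List.range k).map fun i => colMat n x (y (i + j)) (i + j)).prod =
      C * (Rmat n (j + k + 1) (x 2 / x 0) * Rmat n (j + k) (x 1 / x 0)) := by
  induction k with
  | zero => exact ⟨1, by simp⟩
  | succ k ih =>
    obtain ⟨C, hC⟩ := ih (by omega)
    obtain ⟨D, hD⟩ := Rmat_pair_mul_colMat hn (j := k + j) (by omega) x (y (k + j)) hx
    refine ⟨C * D, ?_⟩
    rw [List.range_succ, List.map_append, List.prod_append, List.map_singleton,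
      List.prod_singleton, ← mul_assoc, hC, mul_assoc C, add_comm j k, hD, mul_assoc,
      show k + j + 2 = j + (k + 1) + 1 by omega, show k + j + 1 = j + (k + 1) by omega]

theorem Zmat_labP_right_eq_zero {n : ℕ} (hn : 3 ≤ n) {x y : ℕ → F} (hx0 : x 0 ≠ 0)
    (hx : x 0 = y 1) (hxt : x 0 = tt * x 2) (v : Equiv.Perm (Fin n)) (κ : Lab n) :
    Zmat n x y κ (labP n v) = 0 := by
  obtain ⟨m, rfl⟩ := Nat.exists_eq_add_of_le' hn
  set N := m + 3 with hN
  have hZ := Zmat_add_two (m + 1) x y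
  rw [show m + 1 + 2 = N from rfl] at hZ
  rw [hZ]
  obtain ⟨C, hC⟩ := Rmat_pair_mul_prod_colMat (n := N) (j := 2) hn x y hx0 (m + 1) (by omega)
  generalize (List.map (fun j => colMat N x (y (j + 2)) (j + 2)) (List.range (m + 1))).prod = W at *
  obtain ⟨H, hcol⟩ : ∃ H, colMat N x (y 1) 1 =
      H * (Rmat N (2 + 1) (x 2 / x 0) * Rmat N 2 (x 1 / x 0)) := by
    refine ⟨(1 - tt) • descProd (fun i => Rmat N (1 + (i + 3)) (x (i + 3) / y 1)) m, ?_⟩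
    rw [colMat, descProd_add_three, ← hx, div_self hx0]
    simp [Rmat_one]
  rw [hcol, mul_assoc, mul_assoc H, hC, ← mul_assoc, ← mul_assoc, ← mul_assoc,
    mul_Rmat_apply_of_eq (by omega), mul_Rmat_apply_of_eq (by omega), div_mul_eq_mul_div,
    mul_comm (x 2), ← hxt, div_self hx0, sub_self, mul_zero, zero_mul]
  all_goals rw [labP_of_le, labP_of_le] <;> simp <;> omega

/-- the wheel conditions: `f(1ₙ)(x, tx, qx, x₄,…,xₙ) = 0` and
`f(1ₙ)(tqx, tx, qx, x₄,…,xₙ) = 0`, where `x` is a new indeterminate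
(realized here by `yy 0`, which is algebraically independent from `q`, `t` and the `xx k`). -/
theorem statement9 (n : ℕ) (hn : 3 ≤ n) :
    pf1 n (fun k =>
        if k = 0 then yy 0 else if k = 1 then tt * yy 0 else if k = 2 then qq * yy 0
        else xx k) = 0 ∧
      pf1 n (fun k =>
        if k = 0 then tt * qq * yy 0 else if k = 1 then tt * yy 0
        else if k = 2 then qq * yy 0 else xx k) = 0 := by
  constructor
  · unfold pf1
    rw [Zmat_labP_left_eq_zero hn, mul_zero]
    · simpa using ⟨qq_ne_zero, yy_ne_zero 0⟩
    · simp
    · simp [mul_left_comm]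
  · unfold pf1
    rw [Zmat_labP_right_eq_zero hn, mul_zero]
    · simpa using ⟨⟨tt_ne_zero, qq_ne_zero⟩, yy_ne_zero 0⟩
    · simp [mul_left_comm, mul_assoc]
    · simp [mul_assoc]
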